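/- For every i ≥ 1 with s_i < ∞, the set 𝒟_i is nonempty and finite. -/

import Mathlib

/-! Core combinatorial definitions for the jumping-polynomial construction. -/

namespace Jump

/-- Tuples of nonnegative integers, indexed by positive integers (index 0 unused). -/
abbrev Vec := ℕ → ℕ

/-- Pairs of tuples. -/
abbrev PVec := Vec × Vec

/-- `A` is a tuple in `ℕ₀^k` (entries indexed by `1, …, k`). -/
def Supp (k : ℕ) (A : Vec) : Prop := ∀ j : ℕ, (j = 0 ∨ k < j) → A j = 0

/-- `A` is a tuple in `ℤ^k` (entries indexed by `1, …, k`). -/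
def SuppZ (k : ℕ) (A : ℕ → ℤ) : Prop := ∀ j : ℕ, (j = 0 ∨ k < j) → A j = 0

/-- `(A, C)` is irreducible with respect to a set `T` of pairs of tuples: no member of `T`
is componentwise less than or equal to `(A, C)`. -/
def Irr (T : Set PVec) (p : PVec) : Prop := ∀ bd ∈ T, ¬ (bd.1 ≤ p.1 ∧ bd.2 ≤ p.2)

/-- The weight `A·β(k) = a₁β₁ + ⋯ + a_kβ_k` of a tuple of nonnegative integers. -/
noncomputable def wtA (β : ℕ → ℝ) (k : ℕ) (A : Vec) : ℝ :=
  ∑ j ∈ Finset.Icc 1 k, (A j : ℝ) * β j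

/-- The weight of a tuple of integers. -/
noncomputable def wtZ (β : ℕ → ℝ) (k : ℕ) (A : ℕ → ℤ) : ℝ :=
  ∑ j ∈ Finset.Icc 1 k, (A j : ℝ) * β j

/-- The weight `|(A, C)| = A·β(k) + C·γ(i)` of a pair of tuples. -/
noncomputable def wt (β γ : ℕ → ℝ) (k i : ℕ) (p : PVec) : ℝ :=
  wtA β k p.1 + wtA γ i p.2

/-- The group `G_n = β₁ℤ + ⋯ + β_nℤ` (as a subset of `ℝ`; `G_0 = {0}`). -/
noncomputable def Gr (β : ℕ → ℝ) (n : ℕ) : Set ℝ :=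
  {t | ∃ A : ℕ → ℤ, SuppZ n A ∧ t = wtZ β n A}

/-- The semigroup `S_n = β₁ℕ₀ + ⋯ + β_nℕ₀` (as a subset of `ℝ`; `S_0 = {0}`). -/
noncomputable def Sg (β : ℕ → ℝ) (n : ℕ) : Set ℝ :=
  {t | ∃ A : Vec, Supp n A ∧ t = wtA β n A}

/-- The set `G_k + H_i`. -/
noncomputable def GrH (β γ : ℕ → ℝ) (k i : ℕ) : Set ℝ :=
  {t | ∃ a ∈ Gr β k, ∃ b ∈ Gr γ i, t = a + b}

/-- The set `G + H_i`, where `G = ⋃_{n ≤ len} G_n`. -/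
noncomputable def GH (β γ : ℕ → ℝ) (len : ℕ∞) (i : ℕ) : Set ℝ :=
  {t | ∃ k : ℕ, (k : ℕ∞) ≤ len ∧ t ∈ GrH β γ k i}

/-- The set `S_k + U_i`. -/
noncomputable def SU (β γ : ℕ → ℝ) (k i : ℕ) : Set ℝ :=
  {t | ∃ a ∈ Sg β k, ∃ b ∈ Sg γ i, t = a + b}

/-- The `j`-th standard basis vector `E_j`. -/
def unitVec (j : ℕ) : Vec := fun l => if l = j then 1 else 0

/-- The set `𝒫 = {(q_jE_j, 0̄) : j ≥ 2, q_j < ∞}`. -/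
def Pset (q : ℕ → ℕ∞) : Set PVec :=
  {p | ∃ j : ℕ, 2 ≤ j ∧ ∃ t : ℕ, q j = (t : ℕ∞) ∧
        p = (fun l => t * unitVec j l, fun _ => 0)}

/-- `(A, C) ∈ ℕ₀^{m_i} × ℕ₀^i` pushes `γ_i`: `c_i > 0` and `|(A, C)| ∈ S_{m_i} + U_{i-1}`. -/
noncomputable def Push (β γ : ℕ → ℝ) (mi i : ℕ) (p : PVec) : Prop :=
  0 < p.2 i ∧ wt β γ mi i p ∈ SU β γ mi (i - 1)

/-- `(A, C)` is reduced: it pushes `γ_i` and no pair strictly below it (componentwise) does. -/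
noncomputable def Red (β γ : ℕ → ℝ) (mi i : ℕ) (p : PVec) : Prop :=
  Push β γ mi i p ∧
    ∀ p' : PVec, p'.1 ≤ p.1 → p'.2 ≤ p.2 → p' ≠ p → ¬ Push β γ mi i p'

/-- The set `𝒟_i`, built from `𝒯_i`: empty if `s_i = ∞`, otherwise the pairs in
`ℕ₀^{m_i} × ℕ₀^i` that are irreducible with respect to `𝒯_i` and reduced. -/
noncomputable def Dstep (β γ : ℕ → ℝ) (s : ℕ → ℕ∞) (m : ℕ → ℕ) (i : ℕ)
    (Ti : Set PVec) : Set PVec :=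
  if s i = ⊤ then ∅ else
    {p | Supp (m i) p.1 ∧ Supp i p.2 ∧ Irr Ti p ∧ Red β γ (m i) i p}

/-- The chain `𝒯_1 = 𝒫`, `𝒯_{i+1} = 𝒯_i ∪ 𝒟_i` (here `Tchain 0 = Tchain 1 = 𝒫`,
which is forced by the convention `s 0 = ⊤`). -/
noncomputable def Tchain (β γ : ℕ → ℝ) (q s : ℕ → ℕ∞) (m : ℕ → ℕ) : ℕ → Set PVec
  | 0 => Pset q
  | n + 1 => Tchain β γ q s m n ∪ Dstep β γ s m n (Tchain β γ q s m n)

/-- The set `𝒯 = ⋃_i 𝒯_i`. -/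
noncomputable def Tfull (β γ : ℕ → ℝ) (q s : ℕ → ℕ∞) (m : ℕ → ℕ) : Set PVec :=
  ⋃ n, Tchain β γ q s m n

/-- A tuple `A ∈ ℤ^k` is permissible: `0 ≤ a_j < q_j` for all `1 ≤ j ≤ k` with `q_j < ∞`. -/
def PermZ (q : ℕ → ℕ∞) (k : ℕ) (A : ℕ → ℤ) : Prop :=
  ∀ j : ℕ, 1 ≤ j → j ≤ k → ∀ t : ℕ, q j = (t : ℕ∞) → 0 ≤ A j ∧ A j < (t : ℤ)

/-- A tuple `A ∈ ℕ₀^k` is permissible: `a_j < q_j` for all `1 ≤ j ≤ k` with `q_j < ∞`. -/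
def PermN (q : ℕ → ℕ∞) (k : ℕ) (A : Vec) : Prop :=
  ∀ j : ℕ, 1 ≤ j → j ≤ k → ∀ t : ℕ, q j = (t : ℕ∞) → A j < t

/-- The abstract combinatorial setup of the jumping-polynomial construction:
a finite (of length `len`) or infinite (`len = ⊤`) sequence `β` of positive reals,
a sequence `γ` of nonnegative reals, and the derived data `q_j`, `s_i`, `m_i`
defined by their minimality properties. -/
structure Setup where
  /-- the length of the `β`-sequence (possibly `∞`) -/
  len : ℕ∞
  β : ℕ → ℝ
  γ : ℕ → ℝ
  q : ℕ → ℕ∞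
  s : ℕ → ℕ∞
  m : ℕ → ℕ
  hlen : 2 ≤ len
  hβ : ∀ j : ℕ, 1 ≤ j → (j : ℕ∞) ≤ len → 0 < β j
  hγ : ∀ i : ℕ, 1 ≤ i → 0 ≤ γ i
  hq1 : q 1 = ⊤
  hqtop : ∀ j : ℕ, len < (j : ℕ∞) → q j = ⊤
  hq : ∀ j : ℕ, 2 ≤ j → (j : ℕ∞) ≤ len →
    q j = sInf {x : ℕ∞ | ∃ t : ℕ, x = (t : ℕ∞) ∧ 0 < t ∧ (t : ℝ) * β j ∈ Gr β (j - 1)}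
  /-- if `q_j = ∞` then `β_j` is the last term of the `β`-sequence, and conversely -/
  hlast : ∀ j : ℕ, 2 ≤ j → (j : ℕ∞) ≤ len → (q j = ⊤ ↔ len = (j : ℕ∞))
  /-- `β_{j+1} > q_jβ_j` whenever `q_j < ∞` -/
  hgrow : ∀ j : ℕ, 2 ≤ j → (j : ℕ∞) ≤ len → ∀ t : ℕ, q j = (t : ℕ∞) →
    (t : ℝ) * β j < β (j + 1)
  hs0 : s 0 = ⊤
  hs : ∀ i : ℕ, 1 ≤ i →
    s i = sInf {x : ℕ∞ | ∃ t : ℕ, x = (t : ℕ∞) ∧ 0 < t ∧ (t : ℝ) * γ i ∈ GH β γ len (i - 1)}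
  hm0 : m 0 = 1
  hmtop : ∀ i : ℕ, 1 ≤ i → s i = ⊤ → m i = m (i - 1)
  hmfin : ∀ i : ℕ, 1 ≤ i → ∀ t : ℕ, s i = (t : ℕ∞) →
    m i = max (m (i - 1))
      (sInf {j : ℕ | 1 ≤ j ∧ (j : ℕ∞) ≤ len ∧ (t : ℝ) * γ i ∈ GrH β γ j (i - 1)})
  hmlen : ∀ i : ℕ, 1 ≤ m i ∧ ((m i : ℕ) : ℕ∞) ≤ len

end Jump

namespace Jump

theorem wtA_add (β : ℕ → ℝ) (k : ℕ) (A B : Vec) :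
    wtA β k (A + B) = wtA β k A + wtA β k B := by
  simp [wtA, add_mul, Finset.sum_add_distrib]

theorem wtA_extend (β : ℕ → ℝ) {k n : ℕ} (h : k ≤ n) {A : Vec} (hA : Supp k A) :
    wtA β n A = wtA β k A := by
  symm
  apply Finset.sum_subset (Finset.Icc_subset_Icc le_rfl h)
  intro j hj hjk
  rw [Finset.mem_Icc] at hj hjk
  rw [hA j (Or.inr (by omega))]
  simp

theorem Supp.mono {k n : ℕ} (h : k ≤ n) {A : Vec} (hA : Supp k A) : Supp n A :=
  fun j hj => hA j (by omega)

theorem Supp.add {k : ℕ} {A B : Vec} (hA : Supp k A) (hB : Supp k B) : Supp k (A + B) :=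
  fun j hj => by simp [hA j hj, hB j hj]

theorem Supp.of_le {k : ℕ} {A B : Vec} (hB : Supp k B) (h : A ≤ B) : Supp k A :=
  fun j hj => Nat.le_zero.mp (hB j hj ▸ h j)

theorem wtA_mul_unitVec (β : ℕ → ℝ) {j k : ℕ} (hj : 1 ≤ j) (hjk : j ≤ k) (t : ℕ) :
    wtA β k (fun l => t * unitVec j l) = t * β j := by
  unfold wtA unitVec
  rw [Finset.sum_eq_single j]
  · simp
  · intro l _ hl
    simp [hl]
  · intro h
    exact absurd (Finset.mem_Icc.mpr ⟨hj, hjk⟩) h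

theorem supp_mul_unitVec {j k : ℕ} (hj : 1 ≤ j) (hjk : j ≤ k) (t : ℕ) :
    Supp k (fun l => t * unitVec j l) := by
  intro l hl
  have : l ≠ j := by omega
  simp [unitVec, this]

theorem Gr_mono (β : ℕ → ℝ) {k n : ℕ} (h : k ≤ n) : Gr β k ⊆ Gr β n := by
  rintro _ ⟨A, hA, rfl⟩
  refine ⟨A, fun j hj => hA j (by omega), ?_⟩
  apply Finset.sum_subset (Finset.Icc_subset_Icc le_rfl h)
  intro j hj hjk
  rw [Finset.mem_Icc] at hj hjk
  rw [hA j (Or.inr (by omega))]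
  simp

theorem Gr_add_int_mul {β : ℕ → ℝ} {n : ℕ} {x y : ℝ} (hx : x ∈ Gr β n) (hy : y ∈ Gr β n)
    (z : ℤ) : x + z * y ∈ Gr β n := by
  obtain ⟨A, hA, rfl⟩ := hx
  obtain ⟨B, hB, rfl⟩ := hy
  refine ⟨fun j => A j + z * B j, fun j hj => by simp [hA j hj, hB j hj], ?_⟩
  simp [wtZ, add_mul, Finset.sum_add_distrib, Finset.mul_sum, mul_assoc]

/-- Every element of `G_{n+1}` is an element of `G_n` plus an integer multiple of `β_{n+1}`. -/
theorem Gr_succ_decomp {β : ℕ → ℝ} {n : ℕ} {x : ℝ} (hx : x ∈ Gr β (n + 1)) :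
    ∃ y ∈ Gr β n, ∃ a : ℤ, x = y + a * β (n + 1) := by
  obtain ⟨A, hA, rfl⟩ := hx
  refine ⟨_, ⟨fun j => if j ≤ n then A j else 0, ?_, rfl⟩, A (n + 1), ?_⟩
  · rintro j (rfl | hj)
    · simp [hA 0 (Or.inl rfl)]
    · simp [Nat.not_le.mpr hj]
  · rw [wtZ, Finset.sum_Icc_succ_top (by omega), wtZ]
    congr 1
    apply Finset.sum_congr rfl
    intro j hj
    simp [(Finset.mem_Icc.mp hj).2]

theorem Sg_succ {β : ℕ → ℝ} {n : ℕ} {y : ℝ} (hy : y ∈ Sg β n) (r : ℕ) :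
    y + r * β (n + 1) ∈ Sg β (n + 1) := by
  obtain ⟨A, hA, rfl⟩ := hy
  refine ⟨A + fun l => r * unitVec (n + 1) l,
    (hA.mono n.le_succ).add (supp_mul_unitVec (by omega) le_rfl r), ?_⟩
  rw [wtA_add, wtA_mul_unitVec β (by omega) le_rfl, wtA_extend β n.le_succ hA]

theorem exists_nat_of_sInf {P : ℕ → Prop} {a : ℕ∞}
    (ha : a = sInf {x : ℕ∞ | ∃ t : ℕ, x = (t : ℕ∞) ∧ P t}) (hfin : a ≠ ⊤) :
    ∃ t : ℕ, a = t ∧ P t := by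
  have hne : {x : ℕ∞ | ∃ t : ℕ, x = (t : ℕ∞) ∧ P t}.Nonempty := by
    by_contra h
    rw [Set.not_nonempty_iff_eq_empty] at h
    rw [h, sInf_empty] at ha
    exact hfin ha
  have := csInf_mem hne
  rwa [← ha] at this

theorem Setup.q_spec (d : Setup) {j t : ℕ} (hj : 2 ≤ j) (hjl : (j : ℕ∞) ≤ d.len)
    (ht : d.q j = t) : 0 < t ∧ (t : ℝ) * d.β j ∈ Gr d.β (j - 1) := by
  obtain ⟨t', ht', h⟩ := exists_nat_of_sInf (d.hq j hj hjl) (by simp [ht])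
  rw [ht, Nat.cast_inj] at ht'
  exact ht' ▸ h

/-- Elements of `G_n` that are at least `β_{n+1}` lie in the semigroup `S_n`. -/
theorem Setup.mem_Sg_of_le (d : Setup) (n : ℕ) (hn : ((n + 2 : ℕ) : ℕ∞) ≤ d.len) :
    ∀ x ∈ Gr d.β (n + 1), d.β (n + 2) ≤ x → x ∈ Sg d.β (n + 1) := by
  induction n with
  | zero =>
    intro x hx hle
    obtain ⟨y, ⟨B, hB, rfl⟩, a, rfl⟩ := Gr_succ_decomp hx
    have h2 := d.hβ 2 (by omega) hn
    have h1 := d.hβ 1 le_rfl (le_trans (by norm_num) hn)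
    have ha : 0 ≤ a := by
      by_contra! h
      have : (a : ℝ) < 0 := by exact_mod_cast h
      simp [wtZ] at hle
      nlinarith
    lift a to ℕ using ha
    have := Sg_succ (β := d.β) (n := 0) (y := 0) ⟨0, fun _ _ => rfl, by simp [wtA]⟩ a
    simpa [wtZ] using this
  | succ n ih =>
    have hlt : ((n + 2 : ℕ) : ℕ∞) < d.len :=
      lt_of_lt_of_le (by exact_mod_cast Nat.lt_succ_self _) hn
    intro x hx hle
    obtain ⟨y, hy, a, rfl⟩ := Gr_succ_decomp hx
    have hq : d.q (n + 2) ≠ ⊤ := fun h =>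
      hlt.ne' ((d.hlast (n + 2) (by omega) hlt.le).mp h)
    obtain ⟨t, ht⟩ := ENat.ne_top_iff_exists.mp hq
    obtain ⟨ht0, htG⟩ := d.q_spec (by omega) hlt.le ht.symm
    have hg := d.hgrow (n + 2) (by omega) hlt.le t ht.symm
    have hβ := d.hβ (n + 2) (by omega) hlt.le
    have ht0' : (0 : ℤ) < t := by exact_mod_cast ht0
    obtain ⟨r, hr⟩ : ∃ r : ℕ, a % (t : ℤ) = r :=
      ⟨(a % t).toNat, (Int.toNat_of_nonneg (Int.emod_nonneg _ ht0'.ne')).symm⟩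
    have hrt : (r : ℤ) + 1 ≤ t := by
      have := Int.emod_lt_of_pos a ht0'
      omega
    have hrt' : (r : ℝ) + 1 ≤ t := by exact_mod_cast hrt
    have ha : a = r + t * (a / t) := by rw [← hr, Int.emod_add_mul_ediv]
    have hy' := Gr_add_int_mul hy htG (a / t)
    have key : y + a * d.β (n + 2) =
        (y + (a / t : ℤ) * (t * d.β (n + 2))) + r * d.β (n + 2) := by
      have : (a : ℝ) = r + t * (a / t : ℤ) := by exact_mod_cast ha
      rw [this]
      ring
    change d.β (n + 3) ≤ y + a * d.β (n + 2) at hle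
    change y + a * d.β (n + 2) ∈ _
    rw [key] at hle ⊢
    refine Sg_succ (ih hlt.le _ hy' ?_) r
    change (t : ℝ) * d.β (n + 2) < d.β (n + 3) at hg
    nlinarith

theorem Setup.q_mul_mem_Sg (d : Setup) {j t : ℕ} (hj : 2 ≤ j) (hjl : (j : ℕ∞) ≤ d.len)
    (ht : d.q j = t) : (t : ℝ) * d.β j ∈ Sg d.β (j - 1) := by
  obtain ⟨n, rfl⟩ := Nat.exists_eq_add_of_le' hj
  obtain ⟨ht0, htG⟩ := d.q_spec hj hjl ht
  refine d.mem_Sg_of_le n hjl _ htG ?_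
  have ht1 : (1 : ℝ) ≤ t := by exact_mod_cast ht0
  nlinarith [d.hβ (n + 2) (by omega) hjl]

/-- A nonempty family of functions agreeing from index `n` on has a member that is minimal
for the colexicographic order. -/
theorem exists_colex_minimal (n : ℕ) : ∀ X : Set Vec, X.Nonempty →
    (∀ f ∈ X, ∀ g ∈ X, ∀ l, n ≤ l → f l = g l) →
    ∃ f ∈ X, ∀ g ∈ X, ∀ k, (∀ l, k < l → g l = f l) → f k ≤ g k := by
  induction n with
  | zero =>
    rintro X ⟨f, hf⟩ h
    exact ⟨f, hf, fun g hg k _ => (h f hf g hg k k.zero_le).le⟩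
  | succ n ih =>
    intro X hX h
    obtain ⟨f₀, hf₀, hmin⟩ := exists_minimal_of_wellFoundedLT (fun v => ∃ f ∈ X, f n = v)
      ⟨_, hX.some, hX.some_mem, rfl⟩
    obtain ⟨f₀, hf₀, rfl⟩ := hf₀
    obtain ⟨f, ⟨hf, hfn⟩, hcol⟩ := ih {g ∈ X | g n = f₀ n} ⟨f₀, hf₀, rfl⟩ (by
      rintro f ⟨hf, hfn⟩ g ⟨hg, hgn⟩ l hl
      rcases hl.eq_or_lt with rfl | hl
      · rw [hfn, hgn]
      · exact h f hf g hg l hl)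
    refine ⟨f, hf, fun g hg k hk => ?_⟩
    rcases lt_trichotomy k n with hkn | rfl | hkn
    · exact hcol g ⟨hg, (hk n hkn).trans hfn⟩ k hk
    · rw [hfn]
      exact (le_total (f₀ k) (g k)).elim id fun hle => hmin ⟨g, hg, rfl⟩ hle
    · exact (h f hf g hg k hkn).le

theorem Setup.m_mono (d : Setup) : Monotone d.m := by
  refine monotone_nat_of_le_succ fun n => ?_
  by_cases h : d.s (n + 1) = ⊤
  · exact (d.hmtop (n + 1) (by omega) h).ge
  · obtain ⟨t, ht⟩ := ENat.ne_top_iff_exists.mp h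
    rw [d.hmfin (n + 1) (by omega) t ht.symm]
    exact le_max_left _ _

theorem mem_Tchain {β γ : ℕ → ℝ} {q s : ℕ → ℕ∞} {m : ℕ → ℕ} {n : ℕ} {p : PVec}
    (hp : p ∈ Tchain β γ q s m n) :
    p ∈ Pset q ∨ ∃ k < n, p ∈ Dstep β γ s m k (Tchain β γ q s m k) := by
  induction n with
  | zero => exact Or.inl hp
  | succ n ih =>
    rcases hp with hp | hp
    · exact (ih hp).imp_right fun ⟨k, hk, h⟩ => ⟨k, by omega, h⟩
    · exact Or.inr ⟨n, by omega, hp⟩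

/-- Some positive multiple of `γ_i` (namely `s_iγ_i`) lies in `G_{m_i} + H_{i-1}`. -/
theorem Setup.s_spec (d : Setup) {i : ℕ} (hi : 1 ≤ i) (hsi : d.s i ≠ ⊤) :
    ∃ t : ℕ, 0 < t ∧ (t : ℝ) * d.γ i ∈ GrH d.β d.γ (d.m i) (i - 1) := by
  obtain ⟨t, hst, ht0, k, hk, htk⟩ := exists_nat_of_sInf (d.hs i hi) hsi
  refine ⟨t, ht0, ?_⟩
  have mono : ∀ {k n}, k ≤ n → GrH d.β d.γ k (i - 1) ⊆ GrH d.β d.γ n (i - 1) := by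
    rintro k n hkn _ ⟨a, ha, b, hb, rfl⟩
    exact ⟨a, Gr_mono d.β hkn ha, b, hb, rfl⟩
  have hne : {j : ℕ | 1 ≤ j ∧ (j : ℕ∞) ≤ d.len ∧
      (t : ℝ) * d.γ i ∈ GrH d.β d.γ j (i - 1)}.Nonempty := by
    refine ⟨max 1 k, le_max_left _ _, ?_, mono (le_max_right _ _) htk⟩
    rcases le_total 1 k with h | h
    · rwa [max_eq_right h]
    · rw [max_eq_left h]
      exact le_trans (by norm_num) d.hlen
  have hmem := Nat.sInf_mem hne
  rw [d.hmfin i hi t hst]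
  exact mono (le_max_right _ _) hmem.2.2

theorem wtZ_eq_sub (β : ℕ → ℝ) (k : ℕ) (A : ℕ → ℤ) :
    wtZ β k A = wtA β k (fun j => (A j).toNat) - wtA β k (fun j => (-A j).toNat) := by
  unfold wtZ wtA
  rw [← Finset.sum_sub_distrib]
  refine Finset.sum_congr rfl fun j _ => ?_
  rw [← sub_mul]
  congr 1
  exact_mod_cast (Int.toNat_sub_toNat_neg (A j)).symm

theorem Setup.exists_push (d : Setup) {i : ℕ} (hi : 1 ≤ i) (hsi : d.s i ≠ ⊤) :
    ∃ p : PVec, Supp (d.m i) p.1 ∧ Supp i p.2 ∧ Push d.β d.γ (d.m i) i p := by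
  obtain ⟨t, ht0, _, ⟨A, hA, rfl⟩, _, ⟨C, hC, rfl⟩, h⟩ := d.s_spec hi hsi
  have hCs : Supp (i - 1) (fun j => (-C j).toNat) := fun j hj => by simp [hC j hj]
  refine ⟨(fun j => (-A j).toNat, (fun j => (-C j).toNat) + fun l => t * unitVec i l),
    fun j hj => by simp [hA j hj],
    (hCs.mono (Nat.sub_le _ _)).add (supp_mul_unitVec hi le_rfl t), ?_, ?_⟩
  · simp [unitVec, ht0]
  · refine ⟨_, ⟨fun j => (A j).toNat, fun j hj => by simp [hA j hj], rfl⟩,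
      _, ⟨fun j => (C j).toNat, fun j hj => by simp [hC j hj], rfl⟩, ?_⟩
    rw [wtZ_eq_sub, wtZ_eq_sub] at h
    rw [wt, wtA_add, wtA_mul_unitVec d.γ hi le_rfl, wtA_extend d.γ (Nat.sub_le _ _) hCs, h]
    ring

/-- There is an irreducible pushing pair: the colexicographically least one, comparing `C` first. -/
theorem Setup.exists_push_irr (d : Setup) {i : ℕ} (hi : 1 ≤ i) (hsi : d.s i ≠ ⊤) :
    ∃ p : PVec, Supp (d.m i) p.1 ∧ Supp i p.2 ∧ Push d.β d.γ (d.m i) i p ∧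
      Irr (Tchain d.β d.γ d.q d.s d.m i) p := by
  obtain ⟨p₀, h₁, h₂, h₃⟩ := d.exists_push hi hsi
  let P : Vec → Vec → Prop := fun A C =>
    Supp (d.m i) A ∧ Supp i C ∧ Push d.β d.γ (d.m i) i (A, C)
  obtain ⟨C, ⟨A₀, hA₀⟩, hCmin⟩ := exists_colex_minimal (i + 1) {C | ∃ A, P A C}
    ⟨p₀.2, p₀.1, h₁, h₂, h₃⟩ (by
      rintro f ⟨_, _, hf, _⟩ g ⟨_, _, hg, _⟩ l hl
      rw [hf l (Or.inr hl), hg l (Or.inr hl)])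
  obtain ⟨A, ⟨hA, hC, hc, hw⟩, hAmin⟩ := exists_colex_minimal (d.m i + 1) {A | P A C}
    ⟨A₀, hA₀⟩ (by
      rintro f ⟨hf, _⟩ g ⟨hg, _⟩ l hl
      rw [hf l (Or.inr hl), hg l (Or.inr hl)])
  refine ⟨(A, C), hA, hC, ⟨hc, hw⟩, ?_⟩
  rintro ⟨B, D⟩ hBD ⟨hBA, hDC⟩
  change B ≤ A at hBA
  change D ≤ C at hDC
  have hAB : A = A - B + B := (tsub_add_cancel_of_le hBA).symm
  have hCD : C = C - D + D := (tsub_add_cancel_of_le hDC).symm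
  have hAB' : Supp (d.m i) (A - B) := hA.of_le tsub_le_self
  have hCD' : Supp i (C - D) := hC.of_le tsub_le_self
  rcases mem_Tchain hBD with ⟨j, hj, t, ht, hp⟩ | ⟨k, hk, hD⟩
  · obtain ⟨rfl, rfl⟩ := Prod.mk.inj hp
    have hjl : (j : ℕ∞) ≤ d.len := by
      by_contra! h
      simp [d.hqtop j h] at ht
    obtain ⟨ht0, -⟩ := d.q_spec hj hjl ht
    have htA : t ≤ A j := by simpa [unitVec] using hBA j
    have hjm : j ≤ d.m i := by
      by_contra! h
      have := hA j (Or.inr h)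
      omega
    obtain ⟨F, hF, hFw⟩ := d.q_mul_mem_Sg hj hjl ht
    set B : Vec := fun l => t * unitVec j l with hB
    have hlt : (A - B + F) j < A j := by
      simp only [hB, Pi.add_apply, Pi.sub_apply, unitVec, hF j (Or.inr (by omega))]
      simp
      omega
    refine hlt.not_ge (hAmin _ ⟨hAB'.add (hF.mono (by omega)), hC, hc, ?_⟩ j ?_)
    · have : wt d.β d.γ (d.m i) i (A - B + F, C) = wt d.β d.γ (d.m i) i (A, C) := by
        conv_rhs => rw [hAB]
        simp only [wt, wtA_add]
        rw [wtA_extend d.β (by omega : j - 1 ≤ d.m i) hF, ← hFw, hB,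
          wtA_mul_unitVec d.β (by omega) hjm]
      rwa [this]
    · intro l hl
      simp [hB, unitVec, hl.ne', hF l (Or.inr (by omega))]
  · unfold Dstep at hD
    split_ifs at hD with hsk
    · exact hD
    obtain ⟨hBs, hDs, -, ⟨hDk, _, ⟨F, hF, rfl⟩, _, ⟨K, hK, rfl⟩, hwt⟩, -⟩ := hD
    change 0 < D k at hDk
    change Supp (d.m k) B at hBs
    change Supp k D at hDs
    have hk1 : 1 ≤ k := by
      rcases Nat.eq_zero_or_pos k with rfl | h
      · exact absurd d.hs0 hsk
      · exact h
    have hmk := d.m_mono hk.le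
    have hDk' : D k ≤ C k := hDC k
    have hlt : (C - D + K) k < C k := by
      simp only [Pi.add_apply, Pi.sub_apply, hK k (Or.inr (by omega))]
      omega
    have heq : ∀ l, k < l → (C - D + K) l = C l := by
      intro l hl
      simp [hDs l (Or.inr hl), hK l (Or.inr (by omega))]
    refine hlt.not_ge (hCmin _ ⟨A - B + F, hAB'.add (hF.mono hmk),
      hCD'.add (hK.mono (by omega)), ?_, ?_⟩ k heq)
    · change 0 < (C - D + K) i
      rw [heq i hk]
      exact hc
    · have : wt d.β d.γ (d.m i) i (A - B + F, C - D + K) =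
          wt d.β d.γ (d.m i) i (A, C) := by
        conv_rhs => rw [hAB, hCD]
        simp only [wt] at hwt
        simp only [wt, wtA_add]
        rw [wtA_extend d.β hmk hF, wtA_extend d.γ (by omega : k - 1 ≤ i) hK,
          wtA_extend d.β hmk hBs, wtA_extend d.γ hk.le hDs]
        linarith
      rwa [this]

theorem Irr.of_le {T : Set PVec} {p p' : PVec} (hp : Irr T p) (h : p' ≤ p) : Irr T p' :=
  fun bd hbd hle => hp bd hbd ⟨hle.1.trans h.1, hle.2.trans h.2⟩

theorem Supp.eq_of_le_of_sum_le {k : ℕ} {A B : Vec} (hB : Supp k B) (h : A ≤ B)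
    (hs : ∑ j ∈ Finset.range (k + 1), B j ≤ ∑ j ∈ Finset.range (k + 1), A j) : A = B := by
  have hle : ∀ j ∈ Finset.range (k + 1), A j ≤ B j := fun j _ => h j
  have := (Finset.sum_eq_sum_iff_of_le hle).mp (le_antisymm (Finset.sum_le_sum hle) hs)
  funext j
  by_cases hj : j < k + 1
  · exact this j (Finset.mem_range.mpr hj)
  · rw [hB j (Or.inr (by omega)), hB.of_le h j (Or.inr (by omega))]

/-- Below every finitely supported pushing pair there is a reduced one. -/
theorem exists_red_le {β γ : ℕ → ℝ} {mi i : ℕ} {p : PVec} (h₁ : Supp mi p.1) (h₂ : Supp i p.2)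
    (hp : Push β γ mi i p) : ∃ p' ≤ p, Red β γ mi i p' := by
  let f : PVec → ℕ := fun r =>
    ∑ j ∈ Finset.range (mi + 1), r.1 j + ∑ j ∈ Finset.range (i + 1), r.2 j
  obtain ⟨p', ⟨hle, hpush⟩, hmin⟩ :=
    WellFounded.has_min (measure f).wf {r | r ≤ p ∧ Push β γ mi i r} ⟨p, le_rfl, hp⟩
  refine ⟨p', hle, hpush, fun r h1 h2 hne hr => ?_⟩
  have hf : ¬ f r < f p' := hmin r ⟨le_trans ⟨h1, h2⟩ hle, hr⟩
  have s1 := Finset.sum_le_sum fun j (_ : j ∈ Finset.range (mi + 1)) => h1 j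
  have s2 := Finset.sum_le_sum fun j (_ : j ∈ Finset.range (i + 1)) => h2 j
  simp only [f] at hf
  exact hne (Prod.ext ((h₁.of_le hle.1).eq_of_le_of_sum_le h1 (by omega))
    ((h₂.of_le hle.2).eq_of_le_of_sum_le h2 (by omega)))

/-- Dickson's lemma for reduced pairs. -/
theorem finite_red (β γ : ℕ → ℝ) (mi i : ℕ) :
    {p : PVec | Supp mi p.1 ∧ Supp i p.2 ∧ Red β γ mi i p}.Finite := by
  by_contra hinf
  let e := Set.Infinite.natEmbedding _ hinf
  let g : ℕ → (Fin (mi + 1) → ℕ) × (Fin (i + 1) → ℕ) := fun n =>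
    (fun j => (e n).1.1 j, fun j => (e n).1.2 j)
  obtain ⟨a, b, hab, hle⟩ := wellQuasiOrdered_le g
  have extend : ∀ {k : ℕ} {A B : Vec}, Supp k A → (∀ j : Fin (k + 1), A j ≤ B j) → A ≤ B := by
    intro k A B hA h j
    by_cases hj : j < k + 1
    · exact h ⟨j, hj⟩
    · rw [hA j (Or.inr (by omega))]
      exact Nat.zero_le _
  obtain ⟨ha₁, ha₂, ha⟩ := (e a).2
  obtain ⟨-, -, hb⟩ := (e b).2
  refine hb.2 (e a).1 (extend ha₁ hle.1) (extend ha₂ hle.2) (fun h => ?_) ha.1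
  exact hab.ne (e.injective (Subtype.ext h))

/-- For every `i ≥ 1` with `s_i < ∞`, the set `𝒟_i` is nonempty and finite. -/
theorem D_nonempty_finite (d : Setup) (i : ℕ) (hi : 1 ≤ i) (hsi : d.s i ≠ ⊤) :
    (Dstep d.β d.γ d.s d.m i (Tchain d.β d.γ d.q d.s d.m i)).Nonempty ∧
    (Dstep d.β d.γ d.s d.m i (Tchain d.β d.γ d.q d.s d.m i)).Finite := by
  unfold Dstep
  rw [if_neg hsi]
  constructor
  · obtain ⟨p, h₁, h₂, hp, hirr⟩ := d.exists_push_irr hi hsi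
    obtain ⟨p', hle, hred⟩ := exists_red_le h₁ h₂ hp
    exact ⟨p', h₁.of_le hle.1, h₂.of_le hle.2, hirr.of_le hle, hred⟩
  · exact (finite_red d.β d.γ (d.m i) i).subset fun p hp => ⟨hp.1, hp.2.1, hp.2.2.2⟩

end Jump
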